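/- Let T > 0 and suppose there exists C > 0 such that the one-dimensional observability inequality ‖v₀‖²_{L²(𝕋)} ≤ C ∫₀ᵀ ‖𝒢(S_λ(t)v₀)‖²_{L²(𝕋)} dt holds for every λ ≥ 0 and every v₀ ∈ L²₀(𝕋). Then, with the same constant C, the two-dimensional observability inequality ‖u₀‖²_{L²(𝕋²)} ≤ C ∫₀ᵀ ‖𝒢⊥(S(t)u₀)‖²_{L²(𝕋²)} dt holds for every u₀ ∈ L²₀(𝕋²). -/

import Mathlib

open MeasureTheory Real Filter

noncomputable section

instance : Fact (0 < 2 * Real.pi) := ⟨by positivity⟩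

/-- The torus `𝕋 = ℝ/2πℤ`. -/
abbrev Torus := AddCircle (2 * Real.pi)
/-- The two-dimensional torus `𝕋² = (ℝ/2πℤ)²`. -/
abbrev Torus2 := Torus × Torus

/-- `L²(𝕋)`. -/
abbrev L2T := Lp ℂ 2 (volume : Measure Torus)
/-- `L²(𝕋²)`. -/
abbrev L2T2 := Lp ℂ 2 (volume : Measure Torus2)

/-- 2D Fourier coefficient `û(k,l) = (1/4π²) ∫_{𝕋²} u(x,y) e^{-i(kx+ly)} dx dy`. -/
def fc2 (u : Torus2 → ℂ) (k l : ℤ) : ℂ :=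
  (1 / (4 * Real.pi ^ 2)) * ∫ p : Torus2, fourier (-k) p.1 * fourier (-l) p.2 * u p

/-- Membership in `L²₀(𝕋²)`: all Fourier coefficients `û(0,l)` vanish. -/
def MeanZero2 (u : L2T2) : Prop := ∀ l : ℤ, fc2 (u : Torus2 → ℂ) 0 l = 0

/-- The multiplier `e^{it(k³ - l²/k)}`. -/
def kpPhase (t : ℝ) (k l : ℤ) : ℂ :=
  Complex.exp (Complex.I * (t : ℂ) * ((k : ℂ) ^ 3 - (l : ℂ) ^ 2 / (k : ℂ)))

/-- Spectral characterization of the linearized KP-II unitary group `S(t)` on `L²₀(𝕋²)`: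
`(S(t)u)^(k,l) = e^{it(k³ - l²/k)} û(k,l)` for `k ≠ 0`, and `S(t)` preserves `L²₀`. -/
def IsKPGroup (S : ℝ → L2T2 →L[ℂ] L2T2) : Prop :=
  ∀ t : ℝ, ∀ u : L2T2, MeanZero2 u →
    MeanZero2 (S t u) ∧
      ∀ k l : ℤ, k ≠ 0 → fc2 (S t u : Torus2 → ℂ) k l = kpPhase t k l * fc2 (u : Torus2 → ℂ) k l

/-- `(𝒢⊥ h)(x,y) = g(x) (h(x,y) - ∫_𝕋 g(x') h(x',y) dx')` (a.e.). -/
def IsGperp (g : Torus → ℝ) (G : L2T2 →L[ℂ] L2T2) : Prop :=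
  ∀ h : L2T2, ∀ᵐ p ∂(volume : Measure Torus2),
    (G h : Torus2 → ℂ) p =
      (g p.1 : ℂ) * ((h : Torus2 → ℂ) p - ∫ x' : Torus, (g x' : ℂ) * (h : Torus2 → ℂ) (x', p.2))

/-- `(𝒢∥ h)(x,y) = g(y) (h(x,y) - ∫_𝕋 g(y') h(x,y') dy')` (a.e.). -/
def IsGpar (g : Torus → ℝ) (G : L2T2 →L[ℂ] L2T2) : Prop :=
  ∀ h : L2T2, ∀ᵐ p ∂(volume : Measure Torus2),
    (G h : Torus2 → ℂ) p =
      (g p.2 : ℂ) * ((h : Torus2 → ℂ) p - ∫ y' : Torus, (g y' : ℂ) * (h : Torus2 → ℂ) (p.1, y'))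

/-- Fourier coefficient `v̂(k) = (1/2π) ∫_𝕋 v(x) e^{-ikx} dx`. -/
def fc (u : Torus → ℂ) (k : ℤ) : ℂ :=
  (1 / (2 * Real.pi)) * ∫ x : Torus, fourier (-k) x * u x

/-- Membership in `L²₀(𝕋)`. -/
def MeanZero (u : L2T) : Prop := fc (u : Torus → ℂ) 0 = 0

/-- Spectral characterization of the unitary group `S_λ(t)` on `L²₀(𝕋)`:
`(S_λ(t)v)^(k) = e^{it(k³ - λ²/k)} v̂(k)` for `k ≠ 0`. -/
def IsLamGroup (lam : ℝ) (S : ℝ → L2T →L[ℂ] L2T) : Prop :=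
  ∀ t : ℝ, ∀ u : L2T, MeanZero u →
    MeanZero (S t u) ∧
      ∀ k : ℤ, k ≠ 0 →
        fc (S t u : Torus → ℂ) k =
          Complex.exp (Complex.I * (t : ℂ) * ((k : ℂ) ^ 3 - (lam : ℂ) ^ 2 / (k : ℂ))) *
            fc (u : Torus → ℂ) k

/-- `(𝒢 v)(x) = g(x) (v(x) - ∫_𝕋 g(x') v(x') dx')` (a.e.). -/
def IsG (g : Torus → ℝ) (G : L2T →L[ℂ] L2T) : Prop :=
  ∀ v : L2T, ∀ᵐ x ∂(volume : Measure Torus),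
    (G v : Torus → ℂ) x =
      (g x : ℂ) * ((v : Torus → ℂ) x - ∫ x' : Torus, (g x' : ℂ) * (v : Torus → ℂ) x')

/-- The Fourier coefficient `fc` agrees with Mathlib's `fourierCoeff`. -/
lemma fc_eq_fourierCoeff (u : Torus → ℂ) (k : ℤ) : fc u k = fourierCoeff u k := by
  rw [fc, fourierCoeff, AddCircle.integral_haarAddCircle, Complex.real_smul]
  simp

lemma fc_congr_ae {u v : Torus → ℂ} (h : u =ᵐ[volume] v) (k : ℤ) : fc u k = fc v k := by
  rw [fc, fc]
  congr 1
  refine integral_congr_ae ?_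
  filter_upwards [h] with x hx
  rw [hx]

lemma norm_fourier_apply (k : ℤ) (x : Torus) : ‖fourier k x‖ = 1 := by
  rw [fourier_apply, Circle.norm_coe]

lemma enorm_sq_eq_lintegral {α : Type*} [MeasurableSpace α] {μ : Measure α} (u : Lp ℂ 2 μ) :
    ‖u‖ₑ ^ 2 = ∫⁻ x, ‖(u : α → ℂ) x‖ₑ ^ 2 ∂μ := by
  have h := eLpNorm_nnreal_pow_eq_lintegral (μ := μ) (f := (u : α → ℂ)) (p := 2) two_ne_zero
  rw [Lp.enorm_def]
  simpa using h

lemma memLp_two_of_lintegral_ne_top {α : Type*} [MeasurableSpace α] {μ : Measure α} {f : α → ℂ}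
    (hf : AEStronglyMeasurable f μ) (h : ∫⁻ x, ‖f x‖ₑ ^ 2 ∂μ ≠ ⊤) : MemLp f 2 μ := by
  refine ⟨hf, ?_⟩
  rw [eLpNorm_lt_top_iff_lintegral_rpow_enorm_lt_top (by simp) (by simp)]
  simpa using h.lt_top

/-- Parseval's identity on the circle of length `2π`, for the unnormalised Lebesgue measure. -/
lemma lintegral_enorm_sq_eq_tsum_fc {w : Torus → ℂ} (hw : MemLp w 2 volume) :
    ∫⁻ x, ‖w x‖ₑ ^ 2 = ENNReal.ofReal (2 * π) * ∑' k : ℤ, ‖fc w k‖ₑ ^ 2 := by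
  have hw' : MemLp w 2 AddCircle.haarAddCircle := memLp_haarAddCircle_iff.2 hw
  have hs := hasSum_sq_fourierCoeff hw'.toLp
  have hcoeff (k : ℤ) : fourierCoeff hw'.toLp k = fc w k := by
    rw [fc_eq_fourierCoeff, fourierCoeff_congr_ae hw'.coeFn_toLp]
  simp only [hcoeff] at hs
  have hn : ∫⁻ x, ‖w x‖ₑ ^ 2 ∂AddCircle.haarAddCircle
      = ENNReal.ofReal (∫ x, ‖hw'.toLp w x‖ ^ 2 ∂AddCircle.haarAddCircle) := by
    rw [ofReal_integral_eq_lintegral_ofReal]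
    · refine lintegral_congr_ae ?_
      filter_upwards [hw'.coeFn_toLp] with x hx
      rw [hx, ENNReal.ofReal_pow (norm_nonneg _), ofReal_norm]
    · exact (memLp_two_iff_integrable_sq_norm (Lp.aestronglyMeasurable _)).1 (Lp.memLp _)
    · exact ae_of_all _ fun x => by positivity
  conv_lhs => rw [AddCircle.volume_eq_smul_haarAddCircle, lintegral_smul_measure, hn]
  rw [← hs.tsum_eq, ENNReal.ofReal_tsum_of_nonneg (fun k => by positivity) hs.summable, smul_eq_mul]
  simp only [ENNReal.ofReal_pow (norm_nonneg _), ofReal_norm]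

lemma enorm_sq_eq_tsum_fc (u : L2T) :
    ‖u‖ₑ ^ 2 = ENNReal.ofReal (2 * π) * ∑' k : ℤ, ‖fc (u : Torus → ℂ) k‖ₑ ^ 2 := by
  rw [enorm_sq_eq_lintegral, lintegral_enorm_sq_eq_tsum_fc (Lp.memLp u)]

lemma integrable_fourier_mul {u : Torus → ℂ} (hu : Integrable u) (k : ℤ) :
    Integrable fun x => fourier k x * u x :=
  hu.bdd_mul (fourier k).continuous.aestronglyMeasurable
    (ae_of_all _ fun x => (norm_fourier_apply k x).le)

lemma integrable_L2T (u : L2T) : Integrable (u : Torus → ℂ) :=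
  (Lp.memLp u).integrable one_le_two

lemma integrable_L2T2 (u : L2T2) : Integrable (u : Torus2 → ℂ) :=
  (Lp.memLp u).integrable one_le_two

lemma fc_sub (u v : L2T) (k : ℤ) :
    fc ((u - v : L2T) : Torus → ℂ) k = fc (u : Torus → ℂ) k - fc (v : Torus → ℂ) k := by
  rw [fc_congr_ae (Lp.coeFn_sub u v), fc, fc, fc, ← mul_sub,
    ← integral_sub (integrable_fourier_mul (integrable_L2T u) _)
      (integrable_fourier_mul (integrable_L2T v) _)]
  simp only [Pi.sub_apply, mul_sub]

/-- An element of `L²(𝕋)` is determined by its Fourier coefficients. -/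
lemma L2T.ext_fc {u v : L2T} (h : ∀ k, fc (u : Torus → ℂ) k = fc (v : Torus → ℂ) k) : u = v := by
  have hz := enorm_sq_eq_tsum_fc (u - v)
  simp only [fc_sub, h, sub_self] at hz
  simpa [sub_eq_zero] using hz

lemma ofReal_sqrt_two_pi_ne_zero : ((√(2 * π) : ℝ) : ℂ) ≠ 0 := by
  exact_mod_cast (Real.sqrt_pos.2 Real.two_pi_pos).ne'

/-- The modulated exponential `c e^{ikx} / √(2π)` as an element of `L²(𝕋)`. -/
def modulatedFourier (c : ℂ) (k : ℤ) : L2T :=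
  ContinuousMap.toLp 2 volume ℂ ((c / (√(2 * π) : ℝ)) • fourier k)

lemma coeFn_modulatedFourier (c : ℂ) (k : ℤ) :
    (modulatedFourier c k : Torus → ℂ) =ᵐ[volume] fun x => c / (√(2 * π) : ℝ) * fourier k x := by
  filter_upwards [ContinuousMap.coeFn_toLp (p := 2) (𝕜 := ℂ) (volume : Measure Torus)
    ((c / (√(2 * π) : ℝ)) • fourier k)] with x hx
  rw [modulatedFourier, hx]
  rfl

lemma inner_modulatedFourier (c : ℂ) (k : ℤ) (v : L2T) :
    inner ℂ (modulatedFourier c k) v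
      = (starRingEnd ℂ) c * (√(2 * π) : ℝ) * fc (v : Torus → ℂ) k := by
  have h : inner ℂ (modulatedFourier c k) v
      = (starRingEnd ℂ) c / (√(2 * π) : ℝ) * ∫ x, fourier (-k) x * (v : Torus → ℂ) x := by
    rw [L2.inner_def, ← integral_const_mul]
    refine integral_congr_ae ?_
    filter_upwards [coeFn_modulatedFourier c k] with x hx
    rw [hx, RCLike.inner_apply', fourier_neg]
    simp [mul_assoc]
  have hs : ((√(2 * π) : ℝ) : ℂ) * (√(2 * π) : ℝ) = 2 * π := by
    rw [← Complex.ofReal_mul, Real.mul_self_sqrt (by positivity)]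
    simp
  have hs0 := ofReal_sqrt_two_pi_ne_zero
  rw [h, fc, ← hs]
  field_simp

lemma fc_modulatedFourier (c : ℂ) (j k : ℤ) :
    fc (modulatedFourier c j : Torus → ℂ) k = if j = k then c / (√(2 * π) : ℝ) else 0 := by
  rw [fc_congr_ae (coeFn_modulatedFourier c j), fc_eq_fourierCoeff, fourierCoeff.const_mul,
    fourierCoeff_fourier]
  simp [Pi.single_apply, eq_comm]

lemma orthonormal_modulatedFourier {c : ℤ → ℂ} (hc : ∀ k, ‖c k‖ = 1) :
    Orthonormal ℂ fun k => modulatedFourier (c k) k := by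
  have hs0 := ofReal_sqrt_two_pi_ne_zero
  rw [orthonormal_iff_ite]
  intro i j
  rw [inner_modulatedFourier, fc_modulatedFourier]
  by_cases hij : i = j
  · subst hij
    rw [if_pos rfl, if_pos rfl, mul_assoc, mul_div_cancel₀ _ hs0, RCLike.conj_mul, hc]
    simp
  · rw [if_neg (Ne.symm hij), if_neg hij, mul_zero]

/-- The Hilbert basis `c k e^{ikx} / √(2π)` of `L²(𝕋)`, for unimodular `c`. -/
def modulatedBasis (c : ℤ → ℂ) (hc : ∀ k, ‖c k‖ = 1) : HilbertBasis ℤ ℂ L2T :=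
  HilbertBasis.mkOfOrthogonalEqBot (orthonormal_modulatedFourier hc) (by
    rw [Submodule.eq_bot_iff]
    intro v hv
    refine L2T.ext_fc fun k => ?_
    have h := (Submodule.mem_orthogonal _ v).1 hv _ (Submodule.subset_span ⟨k, rfl⟩)
    have hs0 := ofReal_sqrt_two_pi_ne_zero
    have hck : (starRingEnd ℂ) (c k) ≠ 0 := by
      rw [ne_eq, map_eq_zero, ← norm_eq_zero, hc]
      exact one_ne_zero
    rw [inner_modulatedFourier] at h
    have h0 : fc (v : Torus → ℂ) k = 0 :=
      (mul_eq_zero.1 h).resolve_left (mul_ne_zero hck hs0)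
    rw [h0, fc_congr_ae (Lp.coeFn_zero ℂ 2 volume)]
    simp [fc])

lemma modulatedBasis_repr (c : ℤ → ℂ) (hc : ∀ k, ‖c k‖ = 1) (v : L2T) (k : ℤ) :
    (modulatedBasis c hc).repr v k
      = (starRingEnd ℂ) (c k) * (√(2 * π) : ℝ) * fc (v : Torus → ℂ) k := by
  rw [HilbertBasis.repr_apply_apply, modulatedBasis, HilbertBasis.coe_mkOfOrthogonalEqBot,
    inner_modulatedFourier]

/-- The unitary operator on `L²(𝕋)` with unimodular Fourier multiplier `c`. -/
def unitaryMultiplier (c : ℤ → ℂ) (hc : ∀ k, ‖c k‖ = 1) : L2T ≃ₗᵢ[ℂ] L2T :=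
  (modulatedBasis (fun _ => 1) (fun _ => norm_one)).repr.trans (modulatedBasis c hc).repr.symm

lemma fc_unitaryMultiplier (c : ℤ → ℂ) (hc : ∀ k, ‖c k‖ = 1) (v : L2T) (k : ℤ) :
    fc (unitaryMultiplier c hc v : Torus → ℂ) k = c k * fc (v : Torus → ℂ) k := by
  have h : (modulatedBasis c hc).repr (unitaryMultiplier c hc v) k
      = (modulatedBasis (fun _ => 1) (fun _ => norm_one)).repr v k := by
    simp [unitaryMultiplier]
  have hs0 := ofReal_sqrt_two_pi_ne_zero
  have hcc : c k * (starRingEnd ℂ) (c k) = 1 := by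
    rw [RCLike.mul_conj, hc]
    simp
  rw [modulatedBasis_repr, modulatedBasis_repr, map_one, one_mul] at h
  refine mul_left_cancel₀ hs0 ?_
  linear_combination c k * h - (√(2 * π) : ℝ) * fc (unitaryMultiplier c hc v : Torus → ℂ) k * hcc

lemma unitaryMultiplier_hasSum (c : ℤ → ℂ) (hc : ∀ k, ‖c k‖ = 1) (v : L2T) :
    HasSum (fun k => ((√(2 * π) : ℝ) * fc (v : Torus → ℂ) k) • c k • modulatedFourier 1 k)
      (unitaryMultiplier c hc v) := by
  have h := (modulatedBasis (fun _ => 1) (fun _ => norm_one)).hasSum_repr (unitaryMultiplier c hc v)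
  convert h using 2 with k
  rw [modulatedBasis_repr, fc_unitaryMultiplier, smul_smul, modulatedBasis,
    HilbertBasis.coe_mkOfOrthogonalEqBot]
  congr 1
  simp
  ring

/-- The phase `e^{it(k³ - λ²/k)}`. -/
def lamPhase (lam t : ℝ) (k : ℤ) : ℂ :=
  Complex.exp (Complex.I * (t : ℂ) * ((k : ℂ) ^ 3 - (lam : ℂ) ^ 2 / (k : ℂ)))

lemma norm_lamPhase (lam t : ℝ) (k : ℤ) : ‖lamPhase lam t k‖ = 1 := by
  have h : Complex.I * (t : ℂ) * ((k : ℂ) ^ 3 - (lam : ℂ) ^ 2 / (k : ℂ))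
      = ((t * ((k : ℝ) ^ 3 - lam ^ 2 / k) : ℝ) : ℂ) * Complex.I := by
    push_cast
    ring
  rw [lamPhase, h, Complex.norm_exp_ofReal_mul_I]

/-- The unitary group `S_λ(t)` on `L²(𝕋)` with phase `e^{it(k³ - λ²/k)}`. -/
def lamGroup (lam t : ℝ) : L2T ≃ₗᵢ[ℂ] L2T :=
  unitaryMultiplier (lamPhase lam t) (norm_lamPhase lam t)

lemma isLamGroup_lamGroup (lam : ℝ) :
    IsLamGroup lam fun t => ((lamGroup lam t).toContinuousLinearEquiv : L2T →L[ℂ] L2T) := by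
  intro t u hu
  refine ⟨?_, fun k _ => fc_unitaryMultiplier _ _ u k⟩
  have h := fc_unitaryMultiplier _ (norm_lamPhase lam t) u 0
  rw [MeanZero] at hu
  rw [hu, mul_zero] at h
  exact h

lemma stronglyMeasurable_lamGroup (lam : ℝ) (v : L2T) :
    StronglyMeasurable fun t => lamGroup lam t v := by
  refine stronglyMeasurable_of_tendsto (atTop : Filter (Finset ℤ))
    (f := fun s t => ∑ k ∈ s, ((√(2 * π) : ℝ) * fc (v : Torus → ℂ) k) •
      lamPhase lam t k • modulatedFourier 1 k) (fun s => ?_)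
    (tendsto_pi_nhds.2 fun t => unitaryMultiplier_hasSum _ (norm_lamPhase lam t) v)
  refine Continuous.stronglyMeasurable (continuous_finsetSum _ fun k _ => ?_)
  have : Continuous fun t => lamPhase lam t k := by
    unfold lamPhase
    fun_prop
  fun_prop

/-- The `l`-th partial Fourier coefficient of `u` in the second variable. -/
def partialFc (u : Torus2 → ℂ) (l : ℤ) (x : Torus) : ℂ := fc (fun y => u (x, y)) l

lemma integrable_fourier_snd_mul {u : Torus2 → ℂ} (hu : Integrable u) (l : ℤ) :
    Integrable fun p : Torus2 => fourier l p.2 * u p :=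
  hu.bdd_mul ((fourier l).continuous.comp continuous_snd).aestronglyMeasurable
    (ae_of_all _ fun p => (norm_fourier_apply l p.2).le)

lemma aestronglyMeasurable_partialFc {u : Torus2 → ℂ} (hu : Integrable u) (l : ℤ) :
    AEStronglyMeasurable (partialFc u l) volume :=
  (integrable_fourier_snd_mul hu (-l)).aestronglyMeasurable.integral_prod_right'.const_mul _

lemma partialFc_congr_ae {u v : Torus2 → ℂ} (h : u =ᵐ[volume] v) (l : ℤ) :
    partialFc u l =ᵐ[volume] partialFc v l := by
  filter_upwards [Measure.ae_ae_of_ae_prod h] with x hx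
  exact fc_congr_ae hx l

lemma ae_memLp_slice (u : L2T2) :
    ∀ᵐ x : Torus, MemLp (fun y => (u : Torus2 → ℂ) (x, y)) 2 volume := by
  have hm : AEStronglyMeasurable (u : Torus2 → ℂ) (volume.prod volume) := Lp.aestronglyMeasurable u
  have hfin : ∫⁻ x : Torus, ∫⁻ y : Torus, ‖(u : Torus2 → ℂ) (x, y)‖ₑ ^ 2 ≠ ⊤ := by
    rw [← lintegral_prod _ (hm.enorm.pow_const 2), ← Measure.volume_eq_prod,
      ← enorm_sq_eq_lintegral]
    simp
  filter_upwards [hm.prodMk_left,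
    ae_lt_top' (hm.enorm.pow_const 2).lintegral_prod_right' hfin] with x hx hx'
  exact memLp_two_of_lintegral_ne_top hx hx'.ne

/-- Parseval's identity in the second variable. -/
lemma enorm_sq_eq_tsum_lintegral_partialFc (u : L2T2) :
    ‖u‖ₑ ^ 2 = ENNReal.ofReal (2 * π) *
      ∑' l : ℤ, ∫⁻ x, ‖partialFc (u : Torus2 → ℂ) l x‖ₑ ^ 2 := by
  have hm : AEStronglyMeasurable (u : Torus2 → ℂ) (volume.prod volume) := Lp.aestronglyMeasurable u
  have hc (l : ℤ) : AEMeasurable (fun x => ‖partialFc (u : Torus2 → ℂ) l x‖ₑ ^ 2) volume :=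
    (aestronglyMeasurable_partialFc (integrable_L2T2 u) l).enorm.pow_const 2
  have hprod : ∫⁻ p, ‖(u : Torus2 → ℂ) p‖ₑ ^ 2
      = ∫⁻ x : Torus, ∫⁻ y : Torus, ‖(u : Torus2 → ℂ) (x, y)‖ₑ ^ 2 :=
    lintegral_prod _ (hm.enorm.pow_const 2)
  rw [enorm_sq_eq_lintegral, hprod, ← lintegral_tsum hc,
    ← lintegral_const_mul'' _ (AEMeasurable.tsum hc)]
  refine lintegral_congr_ae ?_
  filter_upwards [ae_memLp_slice u] with x hx
  exact lintegral_enorm_sq_eq_tsum_fc hx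

lemma memLp_partialFc (u : L2T2) (l : ℤ) : MemLp (partialFc (u : Torus2 → ℂ) l) 2 volume := by
  refine memLp_two_of_lintegral_ne_top (aestronglyMeasurable_partialFc (integrable_L2T2 u) l) ?_
  have h := enorm_sq_eq_tsum_lintegral_partialFc u
  have hpi : ENNReal.ofReal (2 * π) ≠ 0 := by simpa using Real.pi_pos
  intro htop
  rw [ENNReal.tsum_eq_top_of_eq_top ⟨l, htop⟩, ENNReal.mul_top hpi] at h
  simp at h

/-- The `l`-th Fourier mode in `y` of an element of `L²(𝕋²)`, as an element of `L²(𝕋)`. -/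
def fourierMode (u : L2T2) (l : ℤ) : L2T := (memLp_partialFc u l).toLp

lemma coeFn_fourierMode (u : L2T2) (l : ℤ) :
    (fourierMode u l : Torus → ℂ) =ᵐ[volume] partialFc (u : Torus2 → ℂ) l :=
  (memLp_partialFc u l).coeFn_toLp

lemma hasSum_norm_fourierMode_sq (u : L2T2) :
    HasSum (fun l => 2 * π * ‖fourierMode u l‖ ^ 2) (‖u‖ ^ 2) := by
  have h : ‖u‖ₑ ^ 2 = ∑' l, ENNReal.ofReal (2 * π * ‖fourierMode u l‖ ^ 2) := by
    rw [enorm_sq_eq_tsum_lintegral_partialFc, ← ENNReal.tsum_mul_left]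
    refine tsum_congr fun l => ?_
    rw [ENNReal.ofReal_mul Real.two_pi_pos.le, ENNReal.ofReal_pow (norm_nonneg _), ofReal_norm,
      enorm_sq_eq_lintegral]
    congr 1
    refine lintegral_congr_ae ?_
    filter_upwards [coeFn_fourierMode u l] with x hx
    rw [hx]
  have hs := ENNReal.hasSum_toReal (f := fun l => ENNReal.ofReal (2 * π * ‖fourierMode u l‖ ^ 2))
    (by rw [← h]; simp)
  rw [← ENNReal.tsum_toReal_eq fun _ => ENNReal.ofReal_ne_top, ← h] at hs
  simpa [ENNReal.toReal_ofReal, Real.pi_pos.le, mul_nonneg] using hs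

lemma fc_fourierMode (u : L2T2) (k l : ℤ) :
    fc (fourierMode u l : Torus → ℂ) k = fc2 (u : Torus2 → ℂ) k l := by
  have hint : Integrable
      (fun p : Torus2 => fourier (-k) p.1 * fourier (-l) p.2 * (u : Torus2 → ℂ) p)
      (volume.prod volume) := by
    refine ((integrable_fourier_snd_mul (integrable_L2T2 u) (-l)).bdd_mul (c := 1)
      ((fourier (-k)).continuous.comp continuous_fst).aestronglyMeasurable
      (ae_of_all _ fun p => (norm_fourier_apply (-k) p.1).le)).congr (ae_of_all _ fun p => ?_)
    exact (mul_assoc _ _ _).symm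
  have hprod : ∫ p : Torus2, fourier (-k) p.1 * fourier (-l) p.2 * (u : Torus2 → ℂ) p
      = ∫ x : Torus, ∫ y : Torus, fourier (-k) x * fourier (-l) y * (u : Torus2 → ℂ) (x, y) :=
    integral_prod _ hint
  rw [fc_congr_ae (coeFn_fourierMode u l), fc, fc2, hprod]
  have h (x : Torus) : fourier (-k) x * partialFc (u : Torus2 → ℂ) l x
      = 1 / (2 * π) * ∫ y, fourier (-k) x * fourier (-l) y * (u : Torus2 → ℂ) (x, y) := by
    simp only [partialFc, fc, mul_assoc]
    rw [integral_const_mul]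
    ring
  simp only [h]
  rw [integral_const_mul, ← mul_assoc]
  congr 1
  ring

/-- `S(t)` acts on the `l`-th mode as `S_{|l|}(t)`. -/
lemma fourierMode_kpGroup {S : ℝ → L2T2 →L[ℂ] L2T2} (hS : IsKPGroup S) {u : L2T2}
    (hu : MeanZero2 u) (t : ℝ) (l : ℤ) :
    fourierMode (S t u) l = lamGroup |(l : ℝ)| t (fourierMode u l) := by
  refine L2T.ext_fc fun k => ?_
  rw [lamGroup, fc_unitaryMultiplier, fc_fourierMode, fc_fourierMode]
  by_cases hk : k = 0
  · rw [hk, (hS t u hu).1 l, hu l, mul_zero]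
  · rw [(hS t u hu).2 k l hk, kpPhase, lamPhase, ← Complex.ofReal_pow, sq_abs]
    simp

lemma norm_kpGroup {S : ℝ → L2T2 →L[ℂ] L2T2} (hS : IsKPGroup S) {u : L2T2}
    (hu : MeanZero2 u) (t : ℝ) : ‖S t u‖ = ‖u‖ := by
  have h := hasSum_norm_fourierMode_sq (S t u)
  simp only [fourierMode_kpGroup hS hu, LinearIsometryEquiv.norm_map] at h
  have := h.unique (hasSum_norm_fourierMode_sq u)
  exact (sq_eq_sq₀ (norm_nonneg _) (norm_nonneg _)).1 this

/-- The localisation operator `𝒢` exists as a bounded operator on `L²(𝕋)`. -/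
lemma exists_isG {γ : Torus → ℝ} (hγ : Continuous γ) : ∃ G1 : L2T →L[ℂ] L2T, IsG γ G1 := by
  obtain ⟨M, hM⟩ := isCompact_univ.exists_bound_of_continuousOn hγ.continuousOn
  let γc : C(Torus, ℂ) := ⟨fun x => (γ x : ℂ), Complex.continuous_ofReal.comp hγ⟩
  let γL : L2T := ContinuousMap.toLp 2 volume ℂ γc
  have hγL : (γL : Torus → ℂ) =ᵐ[volume] fun x => (γ x : ℂ) := ContinuousMap.coeFn_toLp _ _
  have hmem (v : L2T) : MemLp (fun x => (γ x : ℂ) * (v : Torus → ℂ) x) 2 volume := by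
    refine (Lp.memLp v).of_le_mul (c := M)
      ((Complex.continuous_ofReal.comp hγ).aestronglyMeasurable.mul (Lp.aestronglyMeasurable v))
      (ae_of_all _ fun x => ?_)
    rw [norm_mul]
    gcongr
    simpa using hM x trivial
  let mulγ : L2T →L[ℂ] L2T := LinearMap.mkContinuous
    { toFun := fun v => (hmem v).toLp
      map_add' := fun u v => by
        rw [← MemLp.toLp_add, MemLp.toLp_eq_toLp_iff]
        filter_upwards [Lp.coeFn_add u v] with x hx
        rw [hx]
        simp [mul_add]
      map_smul' := fun c v => by
        rw [RingHom.id_apply, ← MemLp.toLp_const_smul, MemLp.toLp_eq_toLp_iff]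
        filter_upwards [Lp.coeFn_smul c v] with x hx
        rw [hx]
        simp [mul_left_comm] } M (fun v => by
      refine Lp.norm_le_mul_norm_of_ae_le_mul ?_
      filter_upwards [(hmem v).coeFn_toLp] with x hx
      rw [LinearMap.coe_mk, AddHom.coe_mk, hx, norm_mul]
      gcongr
      simpa using hM x trivial)
  refine ⟨mulγ - (innerSL ℂ γL).smulRight γL, fun v => ?_⟩
  have hinner : inner ℂ γL v = ∫ x, (γ x : ℂ) * (v : Torus → ℂ) x := by
    rw [L2.inner_def]
    refine integral_congr_ae ?_
    filter_upwards [hγL] with x hx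
    rw [hx, RCLike.inner_apply', Complex.conj_ofReal]
  have heq : (mulγ - (innerSL ℂ γL).smulRight γL) v
      = (hmem v).toLp - (∫ x, (γ x : ℂ) * (v : Torus → ℂ) x) • γL := by
    rw [← hinner]
    rfl
  rw [heq]
  filter_upwards [Lp.coeFn_sub (hmem v).toLp ((∫ x, (γ x : ℂ) * (v : Torus → ℂ) x) • γL),
    (hmem v).coeFn_toLp, Lp.coeFn_smul (∫ x, (γ x : ℂ) * (v : Torus → ℂ) x) γL, hγL]
    with x h1 h2 h3 h4
  rw [h1, Pi.sub_apply, h2, h3, Pi.smul_apply, h4, smul_eq_mul]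
  ring

/-- `𝒢⊥` acts on each Fourier mode in `y` as `𝒢`. -/
lemma fourierMode_gperp {γ : Torus → ℝ} (hγ : Continuous γ) {G : L2T2 →L[ℂ] L2T2}
    (hG : IsGperp γ G) {G1 : L2T →L[ℂ] L2T} (hG1 : IsG γ G1) (u : L2T2) (l : ℤ) :
    fourierMode (G u) l = G1 (fourierMode u l) := by
  obtain ⟨M, hM⟩ := isCompact_univ.exists_bound_of_continuousOn hγ.continuousOn
  have hu : Integrable (u : Torus2 → ℂ) (volume.prod volume) := integrable_L2T2 u
  have hγu : Integrable (fun p : Torus2 => (γ p.1 : ℂ) * (u : Torus2 → ℂ) p)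
      (volume.prod volume) :=
    hu.bdd_mul ((Complex.continuous_ofReal.comp hγ).comp continuous_fst).aestronglyMeasurable
      (ae_of_all _ fun p => by simpa using hM p.1 trivial)
  have hmean : Integrable fun y : Torus => ∫ x', (γ x' : ℂ) * (u : Torus2 → ℂ) (x', y) :=
    hγu.integral_prod_right
  have hswap : fc (fun y => ∫ x', (γ x' : ℂ) * (u : Torus2 → ℂ) (x', y)) l
      = ∫ x', (γ x' : ℂ) * (fourierMode u l : Torus → ℂ) x' := by
    have hmode : ∫ x', (γ x' : ℂ) * (fourierMode u l : Torus → ℂ) x'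
        = ∫ x', (γ x' : ℂ) * partialFc (u : Torus2 → ℂ) l x' := by
      refine integral_congr_ae ?_
      filter_upwards [coeFn_fourierMode u l] with x hx
      rw [hx]
    have hint : Integrable (Function.uncurry fun x' y =>
        fourier (-l) y * ((γ x' : ℂ) * (u : Torus2 → ℂ) (x', y))) (volume.prod volume) :=
      integrable_fourier_snd_mul hγu (-l)
    simp only [hmode, partialFc, fc, ← integral_const_mul]
    rw [← integral_integral_swap (hint.const_mul (1 / (2 * π : ℂ)))]
    refine integral_congr_ae (ae_of_all _ fun x => integral_congr_ae (ae_of_all _ fun y => ?_))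
    simp only
    ring
  have hpart : partialFc (G u : Torus2 → ℂ) l =ᵐ[volume] fun x =>
      (γ x : ℂ) * (partialFc (u : Torus2 → ℂ) l x
        - fc (fun y => ∫ x', (γ x' : ℂ) * (u : Torus2 → ℂ) (x', y)) l) := by
    refine (partialFc_congr_ae (hG u) l).trans ?_
    filter_upwards [hu.prod_right_ae] with x hx
    simp only [partialFc, fc]
    rw [← mul_sub, ← integral_sub (integrable_fourier_mul hx _) (integrable_fourier_mul hmean _),
      mul_left_comm, ← integral_const_mul (γ x : ℂ)]
    congr 1
    refine integral_congr_ae (ae_of_all _ fun y => ?_)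
    simp only
    ring
  refine Lp.ext ?_
  filter_upwards [coeFn_fourierMode (G u) l, hpart, hG1 (fourierMode u l), coeFn_fourierMode u l]
    with x h1 h2 h3 h4
  rw [h1, h2, h3, h4, hswap]

/-- reduction of 2D observability to the uniform 1D observability, via
Fourier expansion in `y`: if the 1D observability inequality holds with constant `C` for
every `λ ≥ 0`, then the 2D observability inequality for linearized KP-II from a vertical
strip holds with the same constant `C`. -/
theorem oneD_observability_implies_twoD_observability
    -- `g` is a fixed real-valued C² function on `𝕋` (2π-periodic on `ℝ`), nonnegative,
    -- with integral 1, vanishing outside `(a,b) ⊂ (-π,π)`: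
    (g : ℝ → ℝ) (hg_reg : ContDiff ℝ 2 g) (hg_per : Function.Periodic g (2 * Real.pi))
    (hg_nonneg : ∀ x, 0 ≤ g x)
    (a b : ℝ) (ha : -Real.pi < a) (hab : a < b) (hb : b < Real.pi)
    (hg_supp : ∀ x ∈ Set.Ioc (-Real.pi) Real.pi, g x ≠ 0 → x ∈ Set.Ioo a b)
    (hg_int : ∫ x in (-Real.pi)..Real.pi, g x = 1)
    (T : ℝ) (hT : 0 < T) (C : ℝ) (hC : 0 < C)
    (h1d : ∀ lam : ℝ, 0 ≤ lam →
      ∀ S1 : ℝ → L2T →L[ℂ] L2T, IsLamGroup lam S1 →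
        ∀ G1 : L2T →L[ℂ] L2T, IsG hg_per.lift G1 →
          ∀ v₀ : L2T, MeanZero v₀ →
            ‖v₀‖ ^ 2 ≤ C * ∫ t in (0:ℝ)..T, ‖G1 (S1 t v₀)‖ ^ 2) :
    ∀ S : ℝ → L2T2 →L[ℂ] L2T2, IsKPGroup S →
      ∀ G : L2T2 →L[ℂ] L2T2, IsGperp hg_per.lift G →
        ∀ u₀ : L2T2, MeanZero2 u₀ →
          ‖u₀‖ ^ 2 ≤ C * ∫ t in (0:ℝ)..T, ‖G (S t u₀)‖ ^ 2 := by
  intro S hS G hG u₀ hu₀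
  have hγ : Continuous hg_per.lift := continuous_coinduced_dom.2 hg_reg.continuous
  obtain ⟨G1, hG1⟩ := exists_isG hγ
  have hmode (t : ℝ) (l : ℤ) :
      fourierMode (G (S t u₀)) l = G1 (lamGroup |(l : ℝ)| t (fourierMode u₀ l)) := by
    rw [fourierMode_gperp hγ hG hG1, fourierMode_kpGroup hS hu₀]
  have hmeas (l : ℤ) : StronglyMeasurable fun t => 2 * π * ‖fourierMode (G (S t u₀)) l‖ ^ 2 := by
    simp only [hmode]
    exact ((G1.continuous.comp_stronglyMeasurable
      (stronglyMeasurable_lamGroup _ _)).norm.pow 2).const_mul _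
  have hsum (t : ℝ) := hasSum_norm_fourierMode_sq (G (S t u₀))
  have hmeasF : StronglyMeasurable fun t => ‖G (S t u₀)‖ ^ 2 :=
    stronglyMeasurable_of_tendsto (atTop : Filter (Finset ℤ))
      (f := fun s t => ∑ l ∈ s, 2 * π * ‖fourierMode (G (S t u₀)) l‖ ^ 2)
      (fun s => Finset.stronglyMeasurable_fun_sum s fun l _ => hmeas l)
      (tendsto_pi_nhds.2 hsum)
  have hpos (t : ℝ) (l : ℤ) : 0 ≤ 2 * π * ‖fourierMode (G (S t u₀)) l‖ ^ 2 := by positivity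
  have hintF : IntervalIntegrable (fun t => ‖G (S t u₀)‖ ^ 2) volume 0 T := by
    refine intervalIntegrable_const (c := (‖G‖ * ‖u₀‖) ^ 2) |>.mono_fun
      hmeasF.aestronglyMeasurable (ae_of_all _ fun t => ?_)
    beta_reduce
    rw [norm_pow, norm_pow, norm_norm, norm_mul, norm_norm, norm_norm, ← norm_kpGroup hS hu₀ t]
    gcongr
    exact G.le_opNorm _
  have hint (l : ℤ) :
      IntervalIntegrable (fun t => 2 * π * ‖fourierMode (G (S t u₀)) l‖ ^ 2) volume 0 T := by
    refine hintF.mono_fun (hmeas l).aestronglyMeasurable (ae_of_all _ fun t => ?_)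
    beta_reduce
    rw [norm_of_nonneg (hpos t l), norm_of_nonneg (by positivity)]
    exact le_hasSum (hsum t) l fun j _ => hpos t j
  have hobs (l : ℤ) : 2 * π * ‖fourierMode u₀ l‖ ^ 2
      ≤ C * ∫ t in (0:ℝ)..T, 2 * π * ‖fourierMode (G (S t u₀)) l‖ ^ 2 := by
    have hmean : MeanZero (fourierMode u₀ l) := (fc_fourierMode u₀ 0 l).trans (hu₀ l)
    have h := h1d |(l : ℝ)| (abs_nonneg _) _ (isLamGroup_lamGroup _) G1 hG1 _ hmean
    rw [intervalIntegral.integral_const_mul, mul_left_comm]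
    simp only [hmode]
    exact mul_le_mul_of_nonneg_left h Real.two_pi_pos.le
  refine hasSum_le_of_sum_le (hasSum_norm_fourierMode_sq u₀) fun s => ?_
  calc ∑ l ∈ s, 2 * π * ‖fourierMode u₀ l‖ ^ 2
      ≤ ∑ l ∈ s, C * ∫ t in (0:ℝ)..T, 2 * π * ‖fourierMode (G (S t u₀)) l‖ ^ 2 :=
        Finset.sum_le_sum fun l _ => hobs l
    _ = C * ∫ t in (0:ℝ)..T, ∑ l ∈ s, 2 * π * ‖fourierMode (G (S t u₀)) l‖ ^ 2 := by
        rw [intervalIntegral.integral_finsetSum fun l _ => hint l, Finset.mul_sum]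
    _ ≤ C * ∫ t in (0:ℝ)..T, ‖G (S t u₀)‖ ^ 2 := by
        refine mul_le_mul_of_nonneg_left ?_ hC.le
        refine intervalIntegral.integral_mono_on hT.le
          (by simpa only [Finset.sum_fn] using IntervalIntegrable.sum s fun l _ => hint l)
          hintF fun t _ => ?_
        exact sum_le_hasSum s (fun l _ => hpos t l) (hsum t)
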